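/- Let G = (V,E) be a connected graph and let S ⊆ E with |S| = 4. There exists a partition S = S_1 ∪ S_2 with |S_1| = |S_2| = 2 such that the Dodgson polynomial Ψ^{S_1,S_2} is identically zero if and only if there exist edge-disjoint subgraphs G_1 and G_2 with G_1 ∪ G_2 = G such that one of the following holds: (1) |V(G_1) ∩ V(G_2)| ≤ 2 and |E(G_1) ∩ S| = 2; (2) |V(G_1) ∩ V(G_2)| = 1 and |E(G_1) ∩ S| = 1. -/

import Mathlib

/-!  Common definitions: multigraphs, separations, width, minors,
Kirchhoff/Dodgson polynomials, Feynman 5-splitting, enhanced graphs. -/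

noncomputable section

attribute [local instance] Classical.propDecidable

/-- A finite multigraph, given by finite vertex and edge types together with
source and target maps (an arbitrary orientation of each edge). -/
structure Multigraph : Type 1 where
  V : Type
  E : Type
  [fintypeV : Fintype V]
  [fintypeE : Fintype E]
  src : E → V
  tgt : E → V

attribute [instance] Multigraph.fintypeV Multigraph.fintypeE

namespace Multigraph

variable (G : Multigraph)

/-- The endpoints of an edge as an unordered pair. -/
def ends (e : G.E) : Sym2 G.V := s(G.src e, G.tgt e)

/-- Incidence of a vertex with an edge. -/
def inc (v : G.V) (e : G.E) : Prop := v = G.src e ∨ v = G.tgt e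

/-- `V(G_A)`: the vertices of the subgraph induced by an edge set `A`. -/
def edgeVerts (A : Set G.E) : Set G.V := {v | ∃ e ∈ A, G.inc v e}

/-- The order of the separation `(A, Aᶜ)` of the graph `G`,
i.e. `|V(G_A) ∩ V(G_B)|` where `B = Aᶜ`. -/
def sepOrder (A : Set G.E) : ℕ := (G.edgeVerts A ∩ G.edgeVerts Aᶜ).ncard

/-- One step along an edge belonging to the edge set `A`. -/
def stepOn (A : Set G.E) (a b : G.V) : Prop :=
  ∃ e ∈ A, (G.src e = a ∧ G.tgt e = b) ∨ (G.src e = b ∧ G.tgt e = a)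

/-- Reachability using only edges in `A`. -/
def reachOn (A : Set G.E) : G.V → G.V → Prop := Relation.ReflTransGen (G.stepOn A)

/-- Adjacency. -/
def Adj (a b : G.V) : Prop := G.stepOn Set.univ a b

/-- One adjacency step staying inside the vertex set `U`. -/
def stepWithin (U : Set G.V) (a b : G.V) : Prop := a ∈ U ∧ b ∈ U ∧ G.Adj a b

/-- The subgraph induced by the vertex set `U` is (nonempty and) connected. -/
def ConnectedWithin (U : Set G.V) : Prop :=
  U.Nonempty ∧ ∀ a ∈ U, ∀ b ∈ U, Relation.ReflTransGen (G.stepWithin U) a b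

/-- Connectivity of the multigraph. -/
def Connected : Prop := G.ConnectedWithin Set.univ

/-- A multigraph is simple if it has no loops and no parallel edges. -/
def Simple : Prop := (∀ e : G.E, G.src e ≠ G.tgt e) ∧ Function.Injective G.ends

/-- 3-connectivity: at least 4 vertices, and removing fewer than 3 vertices
leaves a connected graph. -/
def ThreeConnected : Prop :=
  4 ≤ Fintype.card G.V ∧ ∀ S : Set G.V, S.ncard < 3 → G.ConnectedWithin Sᶜ

/-- The spanning subgraph with edge set `T` is connected. -/
def ConnectedOn (T : Set G.E) : Prop := ∀ a b : G.V, G.reachOn T a b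

/-- The degree of `v` in the spanning subgraph with edge set `T`
(loops count twice). -/
def degOn (T : Set G.E) (v : G.V) : ℕ :=
  ({e ∈ T | G.src e = v}).ncard + ({e ∈ T | G.tgt e = v}).ncard

/-- The degree of a vertex (loops count twice). -/
def degree (v : G.V) : ℕ := G.degOn Set.univ v

/-- An edge set is a forest (contains no cycle) iff every nonempty subset
has a vertex of degree exactly one. -/
def IsForest (T : Set G.E) : Prop :=
  ∀ T' ⊆ T, T'.Nonempty → ∃ v : G.V, G.degOn T' v = 1

/-- `T` is the edge set of a spanning tree of `G`. -/
def IsSpanningTree (T : Set G.E) : Prop := G.IsForest T ∧ G.ConnectedOn T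

/-- The rank of an edge set in the cycle matroid `M(G)`:
the size of a largest forest contained in it. -/
def rk (A : Set G.E) : ℕ := sSup {n | ∃ T ⊆ A, G.IsForest T ∧ T.ncard = n}

/-- The order of the separation `(A, Aᶜ)` in the cycle matroid `M(G)`,
namely `r(A) + r(Aᶜ) - r(E) + 1`. -/
def msepOrder (A : Set G.E) : ℕ := G.rk A + G.rk Aᶜ + 1 - G.rk Set.univ

/-- The number of connected components of `G_A`, the subgraph induced by the
edge set `A`. -/
def ncompOn (A : Set G.E) : ℕ :=
  ({C : Set G.V | ∃ v ∈ G.edgeVerts A, C = {w | G.reachOn A v w}}).ncard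

/-- `G` has an edge ordering of width at most `k`: every prefix/suffix
separation has order at most `k`. -/
def WidthLE (k : ℕ) : Prop :=
  ∃ f : Fin (Fintype.card G.E) ≃ G.E,
    ∀ ℓ : ℕ,
      G.sepOrder {e | ∃ i : Fin (Fintype.card G.E), f i = e ∧ (i : ℕ) < ℓ} ≤ k

/-- The width of `G`: the minimum width of an edge ordering. -/
def width : ℕ := sInf {k | G.WidthLE k}

/-- The minor of `G` obtained by deleting the edges in `D` and contracting the
edges in `C`. -/
def minorDC (D C : Set G.E) : Multigraph :=
  let rel : G.V → G.V → Prop := fun a b => ∃ e ∈ C, G.src e = a ∧ G.tgt e = b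
  { V := Quot rel
    E := {e : G.E // e ∉ D ∪ C}
    fintypeV := @Fintype.ofFinite _ (Finite.of_surjective (Quot.mk rel) fun q => Quot.exists_rep q)
    fintypeE := Fintype.ofFinite _
    src := fun e => Quot.mk rel (G.src e.1)
    tgt := fun e => Quot.mk rel (G.tgt e.1) }

/-- Deletion of a vertex (together with all incident edges). -/
def deleteVertex (v : G.V) : Multigraph :=
  { V := {w : G.V // w ≠ v}
    E := {e : G.E // ¬ G.inc v e}
    fintypeV := Fintype.ofFinite _
    fintypeE := Fintype.ofFinite _
    src := fun e => ⟨G.src e.1, fun h => e.2 (Or.inl h.symm)⟩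
    tgt := fun e => ⟨G.tgt e.1, fun h => e.2 (Or.inr h.symm)⟩ }

/-- The edges having one endpoint in `X` and the other in `Y`. -/
def crossEdges (X Y : Set G.V) : Set G.E :=
  {e | (G.src e ∈ X ∧ G.tgt e ∈ Y) ∨ (G.src e ∈ Y ∧ G.tgt e ∈ X)}

/-- `G` has `R` as a minor, via branch sets. -/
def HasMinor (R : Multigraph) : Prop :=
  ∃ X : R.V → Set G.V,
    (∀ v : R.V, G.ConnectedWithin (X v)) ∧
    (Pairwise fun v w => Disjoint (X v) (X w)) ∧
    ∀ v w : R.V, v ≠ w →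
      ({f : R.E | R.ends f = s(v, w)}).ncard ≤ (G.crossEdges (X v) (X w)).ncard

/-- `D` is the edge set of a cycle of `G`. -/
def IsCycleSet (D : Set G.E) : Prop :=
  D.Nonempty ∧ (∀ v ∈ G.edgeVerts D, G.degOn D v = 2) ∧
    ∀ a ∈ G.edgeVerts D, ∀ b ∈ G.edgeVerts D, G.reachOn D a b

/-- The side `A` of a separation on `X` is rich: for every `x ∈ X` there is a
cycle `D` avoiding `x` with at most one edge outside `A`. -/
def Rich (A : Set G.E) (X : Set G.V) : Prop :=
  ∀ x ∈ X, ∃ D : Set G.E, G.IsCycleSet D ∧ x ∉ G.edgeVerts D ∧ (D \ A).ncard ≤ 1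

/-- The entry of the (edge × vertex) incidence matrix, as a polynomial. -/
def incCol (e : G.E) (v : G.V) : MvPolynomial G.E ℤ :=
  (if G.src e = v then 1 else 0) - (if G.tgt e = v then 1 else 0)

/-- The expanded Kirchhoff matrix `M_G` (with the column of `v0` deleted). -/
def bigMatrix (v0 : G.V) :
    Matrix (G.E ⊕ {v : G.V // v ≠ v0}) (G.E ⊕ {v : G.V // v ≠ v0}) (MvPolynomial G.E ℤ) :=
  Matrix.of fun r c =>
    match r, c with
    | Sum.inl e, Sum.inl f => if e = f then MvPolynomial.X e else 0
    | Sum.inl e, Sum.inr v => G.incCol e v.1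
    | Sum.inr v, Sum.inl e => - G.incCol e v.1
    | Sum.inr _, Sum.inr _ => 0

/-- The Dodgson polynomial `Ψ^{I,J}_K`: delete the rows indexed by `I` and the
columns indexed by `J` from `M_G`, take the determinant, and set `x_e = 0`
for `e ∈ K`.  (It is well defined up to an overall sign.) -/
def dodgson (v0 : G.V) (I J K : Set G.E) : MvPolynomial G.E ℤ :=
  if h : Nonempty ({e : G.E // e ∉ I} ≃ {e : G.E // e ∉ J}) then
    MvPolynomial.aeval (fun e => if e ∈ K then (0 : MvPolynomial G.E ℤ) else MvPolynomial.X e)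
      (Matrix.det (Matrix.of fun r c =>
        G.bigMatrix v0 (Sum.map Subtype.val id r) (Sum.map (fun x => (h.some x).1) id c)))
  else 0

/-- `(I,J,K)` is one of the 30 Dodgson configurations associated with the
5-configuration `S`. -/
def DodgsonConfig (S I J K : Set G.E) : Prop :=
  I ∪ J ∪ K = S ∧
    ((I.ncard = 2 ∧ J.ncard = 2 ∧ K.ncard = 1 ∧ I ∩ J = ∅ ∧ I ∩ K = ∅ ∧ J ∩ K = ∅) ∨
      (I.ncard = 3 ∧ J.ncard = 3 ∧ K = ∅ ∧ (I ∩ J).ncard = 1))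

/-- The 5-configuration `S` splits: one of its 30 associated Dodgson
polynomials is identically zero. -/
def ConfigSplits (S : Set G.E) : Prop :=
  ∃ I J K : Set G.E, G.DodgsonConfig S I J K ∧ ∀ v0 : G.V, G.dodgson v0 I J K = 0

/-- `G` is Feynman 5-split: every 5-configuration splits. -/
def FeynmanSplit : Prop := ∀ S : Set G.E, S.ncard = 5 → G.ConfigSplits S

/-- `(U, F)` is a subgraph of `G` (every edge of `F` has both ends in `U`). -/
def IsSubgraphPair (U : Set G.V) (F : Set G.E) : Prop :=
  ∀ e ∈ F, G.src e ∈ U ∧ G.tgt e ∈ U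

/-- `G` decomposes into edge-disjoint subgraphs `G₁ ∪ G₂ = G` with
`|V(G₁) ∩ V(G₂)| ≤ 2` and `|E(G₁) ∩ S| = 2`, or with
`|V(G₁) ∩ V(G₂)| = 1` and `|E(G₁) ∩ S| = 1`. -/
def splitWitness (S : Set G.E) : Prop :=
  ∃ (U1 U2 : Set G.V) (F1 F2 : Set G.E),
    G.IsSubgraphPair U1 F1 ∧ G.IsSubgraphPair U2 F2 ∧
    Disjoint F1 F2 ∧ U1 ∪ U2 = Set.univ ∧ F1 ∪ F2 = Set.univ ∧
    (((U1 ∩ U2).ncard ≤ 2 ∧ (F1 ∩ S).ncard = 2) ∨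
      ((U1 ∩ U2).ncard = 1 ∧ (F1 ∩ S).ncard = 1))

/-- A separation of order at most 1 with edges of `S` on both sides, or a
("bad") 2-separation with `min{|A ∩ S|, |B ∩ S|} = 2`. -/
def badSplitSep (S : Set G.E) : Prop :=
  ∃ A : Set G.E,
    (G.sepOrder A ≤ 1 ∧ (A ∩ S).Nonempty ∧ (Aᶜ ∩ S).Nonempty) ∨
      (G.sepOrder A = 2 ∧ min (A ∩ S).ncard (Aᶜ ∩ S).ncard = 2)

/-- Isomorphism of multigraphs. -/
def IsoTo (G' : Multigraph) : Prop :=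
  ∃ (α : G.V ≃ G'.V) (β : G.E ≃ G'.E),
    ∀ e : G.E, G'.ends (β e) = Sym2.map α (G.ends e)

/-- `G` is a tree. -/
def IsTree : Prop := G.Connected ∧ G.IsForest Set.univ

/-- Every vertex has degree 1 or 3. -/
def IsCubic : Prop := ∀ v : G.V, G.degree v = 1 ∨ G.degree v = 3

/-- A leaf. -/
def IsLeaf (v : G.V) : Prop := G.degree v = 1

/-- A cubic caterpillar: a cubic tree whose non-leaf vertices induce a path. -/
def IsCubicCaterpillar : Prop :=
  G.IsTree ∧ G.IsCubic ∧
    (∀ a ∈ {v : G.V | ¬ G.IsLeaf v}, ∀ b ∈ {v : G.V | ¬ G.IsLeaf v},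
      Relation.ReflTransGen (G.stepWithin {v : G.V | ¬ G.IsLeaf v}) a b) ∧
    ∀ v : G.V, ¬ G.IsLeaf v →
      ({e : G.E | G.inc v e ∧ ∃ w : G.V, ¬ G.IsLeaf w ∧ G.inc w e ∧ w ≠ v}).ncard ≤ 2

/-- The branch decomposition `(T, φ)` of the cycle matroid `M(G)` has width at
most `k`: removing any edge `f` of `T` gives a separation of the ground set
of matroid order at most `k`. -/
def branchWidthLE (T : Multigraph) (φ : G.E → T.V) (k : ℕ) : Prop :=
  ∀ f : T.E,
    G.msepOrder {e : G.E | φ e ∈ {x : T.V | T.reachOn {f}ᶜ (T.src f) x}} ≤ k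

/-- `(T, φ)` is a branch decomposition of `M(G)` over a cubic caterpillar. -/
def IsCatDecomp (T : Multigraph) (φ : G.E → T.V) : Prop :=
  T.IsCubicCaterpillar ∧ Function.Injective φ ∧ ∀ e : G.E, T.IsLeaf (φ e)

/-- The caterpillar width of the cycle matroid `M(G)`. -/
def catWidth : ℕ :=
  sInf {k | ∃ (T : Multigraph) (φ : G.E → T.V), G.IsCatDecomp T φ ∧ G.branchWidthLE T φ k}

end Multigraph

/-! ### Concrete graphs -/

/-- The complete graph `K₅`. -/
def K5m : Multigraph where
  V := Fin 5
  E := {p : Fin 5 × Fin 5 // p.1 < p.2}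
  src := fun e => e.1.1
  tgt := fun e => e.1.2

/-- The complete bipartite graph `K₃,₃`. -/
def K33m : Multigraph where
  V := Fin 3 ⊕ Fin 3
  E := Fin 3 × Fin 3
  src := fun e => Sum.inl e.1
  tgt := fun e => Sum.inr e.2

/-- The cube (3-dimensional hypercube) graph `C`. -/
def cubeM : Multigraph where
  V := Fin 2 × Fin 2 × Fin 2
  E := Fin 3 × Fin 2 × Fin 2
  src := fun e =>
    if e.1 = 0 then (0, e.2.1, e.2.2) else if e.1 = 1 then (e.2.1, 0, e.2.2)
      else (e.2.1, e.2.2, 0)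
  tgt := fun e =>
    if e.1 = 0 then (1, e.2.1, e.2.2) else if e.1 = 1 then (e.2.1, 1, e.2.2)
      else (e.2.1, e.2.2, 1)

/-- The octahedron graph `O = K₂,₂,₂`. -/
def octaM : Multigraph where
  V := Fin 3 × Fin 2
  E := {p : (Fin 3 × Fin 2) × (Fin 3 × Fin 2) // p.1.1 < p.2.1}
  src := fun e => e.1.1
  tgt := fun e => e.1.2

/-- The edges of the graph `H` (the cube after a Y–Δ transformation at one
vertex): vertices `0,1,2` form the new triangle, `6` is the antipodal vertex. -/
def hEdgeList : List (Fin 7 × Fin 7) :=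
  [(0,1), (0,2), (1,2), (0,3), (0,4), (1,3), (1,5), (2,4), (2,5), (3,6), (4,6), (5,6)]

/-- The graph `H`, one Δ–Y away from each of the cube and the octahedron. -/
def Hm : Multigraph where
  V := Fin 7
  E := {p : Fin 7 × Fin 7 // p ∈ hEdgeList}
  src := fun e => e.1.1
  tgt := fun e => e.1.2

/-- The complete graph `K₄`. -/
def K4m : Multigraph where
  V := Fin 4
  E := {p : Fin 4 × Fin 4 // p.1 < p.2}
  src := fun e => e.1.1
  tgt := fun e => e.1.2

/-- `K₅⁻`, the complete graph on 5 vertices minus the edge `{3,4}`. -/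
def K5minusM : Multigraph where
  V := Fin 5
  E := {p : Fin 5 × Fin 5 // p.1 < p.2 ∧ ¬(p.1 = 3 ∧ p.2 = 4)}
  src := fun e => e.1.1
  tgt := fun e => e.1.2

/-- The wheel `W_k`: centre `none`; rim edges `Sum.inl i` join `some i` to
`some (i+1)`, spoke edges `Sum.inr i` join the centre to `some i`. -/
def wheelM (k : ℕ) : Multigraph where
  V := Option (Fin k)
  E := Fin k ⊕ Fin k
  src := Sum.elim (fun i => some i) (fun _ => none)
  tgt := Sum.elim (fun i => some (finRotate k i)) (fun i => some i)

/-! ### Enhanced graphs -/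

/-- An enhanced graph: a graph together with sets of contract-proof and
delete-proof edges. -/
structure EGraph : Type 1 where
  G : Multigraph
  Cp : Set G.E
  Dp : Set G.E

namespace EGraph

/-- The 5-configuration `S` of an enhanced graph splits. -/
def Splits (H : EGraph) (S : Set H.G.E) : Prop :=
  H.G.badSplitSep S ∨
    (∃ f ∈ S \ H.Dp, (H.G.minorDC {f} ∅).badSplitSep {e | e.1 ∈ S}) ∨
    (∃ f ∈ S \ H.Cp, (H.G.minorDC ∅ {f}).badSplitSep {e | e.1 ∈ S})

/-- An enhanced graph is non-split if it has a non-split 5-configuration. -/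
def NonSplit (H : EGraph) : Prop := ∃ S : Set H.G.E, S.ncard = 5 ∧ ¬ H.Splits S

/-- Deletion of an edge. -/
def delE (H : EGraph) (f : H.G.E) : EGraph :=
  ⟨H.G.minorDC {f} ∅, {e | e.1 ∈ H.Cp}, {e | e.1 ∈ H.Dp}⟩

/-- Contraction of an edge. -/
def conE (H : EGraph) (f : H.G.E) : EGraph :=
  ⟨H.G.minorDC ∅ {f}, {e | e.1 ∈ H.Cp}, {e | e.1 ∈ H.Dp}⟩

/-- Deletion of a vertex. -/
def delV (H : EGraph) (v : H.G.V) : EGraph :=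
  ⟨H.G.deleteVertex v, {e | e.1 ∈ H.Cp}, {e | e.1 ∈ H.Dp}⟩

/-- Remove an edge from the contract-proof set. -/
def unprotC (H : EGraph) (f : H.G.E) : EGraph := ⟨H.G, H.Cp \ {f}, H.Dp⟩

/-- Remove an edge from the delete-proof set. -/
def unprotD (H : EGraph) (f : H.G.E) : EGraph := ⟨H.G, H.Cp, H.Dp \ {f}⟩

/-- Delete `f'` of a parallel pair `f, f'` and make `f` delete-proof. -/
def parallelReduce (H : EGraph) (f f' : H.G.E) : EGraph :=
  ⟨H.G.minorDC {f'} ∅, {e | e.1 ∈ H.Cp}, {e | e.1 ∈ H.Dp ∨ e.1 = f}⟩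

/-- Contract `f'` of the two edges `f, f'` at a degree-two vertex and make
`f` contract-proof. -/
def seriesReduce (H : EGraph) (f f' : H.G.E) : EGraph :=
  ⟨H.G.minorDC ∅ {f'}, {e | e.1 ∈ H.Cp ∨ e.1 = f}, {e | e.1 ∈ H.Dp}⟩

/-- One step of the enhanced-graph minor relation. -/
inductive MinorStep : EGraph → EGraph → Prop
  | delV (H : EGraph) (v : H.G.V) : MinorStep H (H.delV v)
  | delE (H : EGraph) (f : H.G.E) : MinorStep H (H.delE f)
  | conE (H : EGraph) (f : H.G.E) : MinorStep H (H.conE f)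
  | unprotC (H : EGraph) (f : H.G.E) (hf : f ∈ H.Cp) : MinorStep H (H.unprotC f)
  | unprotD (H : EGraph) (f : H.G.E) (hf : f ∈ H.Dp) : MinorStep H (H.unprotD f)
  | parallel (H : EGraph) (f f' : H.G.E) (hne : f ≠ f')
      (hpar : H.G.ends f = H.G.ends f') : MinorStep H (H.parallelReduce f f')
  | series (H : EGraph) (f f' : H.G.E) (v : H.G.V) (hne : f ≠ f')
      (hf : H.G.inc v f) (hf' : H.G.inc v f')
      (hdeg : ∀ e : H.G.E, H.G.inc v e → e = f ∨ e = f') :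
      MinorStep H (H.seriesReduce f f')

/-- Minor-minimal non-split enhanced graph: non-split, but every proper
enhanced minor is split. -/
def MinorMinimalNonSplit (H : EGraph) : Prop :=
  H.NonSplit ∧ ∀ H' : EGraph, Relation.TransGen MinorStep H H' → ¬ H'.NonSplit

/-- Isomorphism of enhanced graphs. -/
def IsoTo (H H' : EGraph) : Prop :=
  ∃ (α : H.G.V ≃ H'.G.V) (β : H.G.E ≃ H'.G.E),
    (∀ e : H.G.E, H'.G.ends (β e) = Sym2.map α (H.G.ends e)) ∧
    (∀ e : H.G.E, β e ∈ H'.Cp ↔ e ∈ H.Cp) ∧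
    (∀ e : H.G.E, β e ∈ H'.Dp ↔ e ∈ H.Dp)

end EGraph

/-- The edge `01` of `K₄`. -/
def e01K4 : K4m.E := ⟨(0, 1), by decide⟩

/-- The enhanced graph `K₄(1)`: all edges of `K₄` except one are both
contract-proof and delete-proof. -/
def K4one : EGraph := ⟨K4m, {e | e ≠ e01K4}, {e | e ≠ e01K4}⟩

/-! ### The statement -/

open Multigraph

/-- The rank laws of a matroid, for a set function on finsets. -/
structure IsRankFunction {α : Type*} (r : Finset α → ℕ) : Prop where
  empty : r ∅ = 0
  insert_le : ∀ e A, r (insert e A) ≤ r A + 1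
  mono : ∀ A B, A ⊆ B → r A ≤ r B
  submod : ∀ A B, r (A ∪ B) + r (A ∩ B) ≤ r A + r B

/-- Contraction of a set preserves the rank laws. -/
theorem IsRankFunction.contract {α : Type*} {r : Finset α → ℕ} (hr : IsRankFunction r)
    (C : Finset α) : IsRankFunction fun A => r (A ∪ C) - r C where
  empty := by simp
  insert_le e A := by
    have h1 := hr.insert_le e (A ∪ C)
    rw [Finset.insert_union]
    lia
  mono A B h := Nat.sub_le_sub_right (hr.mono _ _ (Finset.union_subset_union_left h)) _
  submod A B := by
    have h1 := hr.submod (A ∪ C) (B ∪ C)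
    rw [← Finset.union_union_distrib_right, ← Finset.inter_union_distrib_right] at h1
    have h2 := hr.mono C (A ∪ C) Finset.subset_union_right
    have h3 := hr.mono C (B ∪ C) Finset.subset_union_right
    have h4 := hr.mono C (A ∪ B ∪ C) Finset.subset_union_right
    have h5 := hr.mono C (A ∩ B ∪ C) Finset.subset_union_right
    lia

/-- Matroid intersection: some common independent set attains a rank bound. -/
theorem IsRankFunction.exists_common_indep {α : Type*} (F : Finset α) :
    ∀ {r₁ r₂ : Finset α → ℕ}, IsRankFunction r₁ → IsRankFunction r₂ →
      ∃ I ⊆ F, ∃ A ⊆ F, r₁ I = I.card ∧ r₂ I = I.card ∧ r₁ A + r₂ (F \ A) ≤ I.card := by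
  induction F using Finset.induction_on with
  | empty =>
    intro r₁ r₂ h₁ h₂
    exact ⟨∅, subset_rfl, ∅, subset_rfl, by simp [h₁.empty], by simp [h₂.empty],
      by simp [h₁.empty, h₂.empty]⟩
  | insert e F heF ih =>
    intro r₁ r₂ h₁ h₂
    obtain ⟨I, hIF, A, hAF, hI₁, hI₂, hA⟩ := ih h₁ h₂
    have heA : e ∉ A := fun h => heF (hAF h)
    by_cases he₁ : r₁ {e} = 0
    · refine ⟨I, hIF.trans (Finset.subset_insert _ _), insert e A,
        Finset.insert_subset_insert _ hAF, hI₁, hI₂, ?_⟩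
      have h3 := h₁.submod A {e}
      have h4 : insert e F \ insert e A = F \ A := by
        ext x; simp only [Finset.mem_sdiff, Finset.mem_insert]; grind
      rw [h4, Finset.insert_eq, Finset.union_comm]
      lia
    by_cases he₂ : r₂ {e} = 0
    · refine ⟨I, hIF.trans (Finset.subset_insert _ _), A,
        hAF.trans (Finset.subset_insert _ _), hI₁, hI₂, ?_⟩
      have h3 := h₂.submod (F \ A) {e}
      have h4 : insert e F \ A = (F \ A) ∪ {e} := by
        ext x; simp only [Finset.mem_sdiff, Finset.mem_insert, Finset.mem_union,
          Finset.mem_singleton]; grind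
      rw [h4]
      lia
    have he₁' : r₁ {e} = 1 := by
      have := h₁.insert_le e ∅
      rw [h₁.empty] at this
      simp only [insert_empty_eq] at this
      lia
    have he₂' : r₂ {e} = 1 := by
      have := h₂.insert_le e ∅
      rw [h₂.empty] at this
      simp only [insert_empty_eq] at this
      lia
    obtain ⟨J, hJF, C, hCF, hJ₁, hJ₂, hC⟩ := ih (h₁.contract {e}) (h₂.contract {e})
    have heJ : e ∉ J := fun h => heF (hJF h)
    simp only [he₁', he₂'] at hJ₁ hJ₂ hC
    have m₁ := h₁.mono {e} (J ∪ {e}) Finset.subset_union_right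
    have m₂ := h₂.mono {e} (J ∪ {e}) Finset.subset_union_right
    have cJ : (J ∪ {e}).card = J.card + 1 := by
      rw [Finset.union_comm, ← Finset.insert_eq, Finset.card_insert_of_notMem heJ]
    by_contra! hcon
    have key : ∀ B ⊆ insert e F, max I.card (J.card + 1) < r₁ B + r₂ (insert e F \ B) := by
      intro B hB
      have a1 := hcon I (hIF.trans (Finset.subset_insert _ _)) B hB hI₁ hI₂
      have a2 := hcon (J ∪ {e}) (by
        rw [Finset.union_comm, ← Finset.insert_eq]
        exact Finset.insert_subset_insert _ hJF) B hB (by lia) (by lia)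
      lia
    have k1 := key (A ∩ (C ∪ {e})) (fun x hx => Finset.mem_insert_of_mem
      (hAF (Finset.mem_inter.1 hx).1))
    have k2 := key (A ∪ (C ∪ {e})) (by
      intro x hx
      simp only [Finset.mem_union, Finset.mem_singleton] at hx
      grind)
    have s1 := h₁.submod A (C ∪ {e})
    have s2 := h₂.submod (F \ A) (F \ C ∪ {e})
    have t1 : insert e F \ (A ∩ (C ∪ {e})) = F \ A ∪ (F \ C ∪ {e}) := by
      ext x; simp only [Finset.mem_sdiff, Finset.mem_insert, Finset.mem_union,
          Finset.mem_singleton, Finset.mem_inter]; grind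
    have t2 : insert e F \ (A ∪ (C ∪ {e})) = (F \ A) ∩ (F \ C ∪ {e}) := by
      ext x; simp only [Finset.mem_sdiff, Finset.mem_insert, Finset.mem_union,
          Finset.mem_singleton, Finset.mem_inter]; grind
    rw [t1] at k1
    rw [t2] at k2
    have m₃ := h₁.mono {e} (C ∪ {e}) Finset.subset_union_right
    have m₄ := h₂.mono {e} (F \ C ∪ {e}) Finset.subset_union_right
    lia

/-- In a connected multigraph on `N` (edges `t` joining `p t` and `q t`) with at most as many
non-loop edges as nodes, four tokens of which at most two share a node are divided two to two by
an edge cut of size at most two, or one to three by a cut of size one. -/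
theorem exists_small_balanced_cut {T L : Type*} [Fintype T] [Fintype L]
    (hL : Fintype.card L = 4) :
    ∀ (n : ℕ) (N : Type) [Fintype N] (p q : T → N) (f : L → N), Fintype.card N = n →
      (∀ s : Set N, s.Nonempty → sᶜ.Nonempty → ∃ t, ¬ (p t ∈ s ↔ q t ∈ s)) →
      ({t | p t ≠ q t} : Set T).ncard ≤ n →
      (∀ x, ({l | f l = x} : Set L).ncard ≤ 2) →
      ∃ s : Set N,
        (({t | ¬ (p t ∈ s ↔ q t ∈ s)} : Set T).ncard ≤ 2 ∧ ({l | f l ∈ s} : Set L).ncard = 2) ∨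
        (({t | ¬ (p t ∈ s ↔ q t ∈ s)} : Set T).ncard = 1 ∧ ({l | f l ∈ s} : Set L).ncard = 1) := by
  intro n
  induction n with
  | zero =>
    intro N _ p q f hN
    have : IsEmpty N := Fintype.card_eq_zero_iff.1 hN
    have : IsEmpty L := ⟨fun l => isEmptyElim (f l)⟩
    simp at hL
  | succ n ih =>
    intro N _ p q f hN hconn hcard hf
    have hfin : ∀ A : Set T, A.Finite := fun A => A.toFinite
    have hsum : ∀ s : Finset N, ∑ x ∈ s, ({l | f l = x} : Set L).ncard =
        ({l | f l ∈ s} : Set L).ncard := by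
      intro s
      rw [Set.ncard_eq_toFinset_card', Finset.card_eq_sum_card_fiberwise (f := f) (t := s)
        (by intro l hl; simpa using hl)]
      refine Finset.sum_congr rfl fun x hx => ?_
      rw [Set.ncard_eq_toFinset_card']
      congr 1
      ext l
      simp only [Set.mem_toFinset, Set.mem_ofPred_eq, Finset.mem_filter]
      grind
    have htot : ∑ x, ({l | f l = x} : Set L).ncard = 4 := by
      rw [hsum]; simp [Set.ncard_univ, hL]
    by_cases hex : ∃ t, p t ≠ q t ∧
        ({l | f l = p t} : Set L).ncard + ({l | f l = q t} : Set L).ncard ≤ 2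
    · obtain ⟨t, ht, hw⟩ := hex
      let π : N → {x : N // x ≠ q t} := fun x =>
        if h : x = q t then ⟨p t, ht⟩ else ⟨x, h⟩
      have hπ : ∀ x y, π x = y ↔ x = y.1 ∨ (x = q t ∧ y.1 = p t) := by
        intro x y
        simp only [π]
        have := y.2
        split_ifs with h <;> simp only [Subtype.ext_iff] <;> grind
      obtain ⟨s, hs⟩ := ih {x : N // x ≠ q t} (π ∘ p) (π ∘ q) (π ∘ f)
        (by simp [Fintype.card_subtype_compl, hN])
        (by
          intro s hs hs'
          have hsurj : Function.Surjective π := fun y => ⟨y.1, (hπ _ _).2 (Or.inl rfl)⟩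
          exact hconn (π ⁻¹' s) (hs.preimage hsurj) (hs'.preimage hsurj))
        (by
          have hlt : ({t | (π ∘ p) t ≠ (π ∘ q) t} : Set T).ncard
              < ({t | p t ≠ q t} : Set T).ncard := by
            refine Set.ncard_lt_ncard ⟨fun a ha hb => ha ?_, fun h => ?_⟩ (hfin _)
            · simp only [Function.comp, hb]
            · refine h (a := t) ht ?_
              exact ((hπ _ ⟨p t, ht⟩).2 (Or.inl rfl)).trans
                ((hπ _ ⟨p t, ht⟩).2 (Or.inr ⟨rfl, rfl⟩)).symm
          lia)
        (by
          intro y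
          by_cases hy : y.1 = p t
          · refine le_trans ?_ hw
            rw [← Set.ncard_union_eq ?_ (Set.toFinite _) (Set.toFinite _)]
            · refine Set.ncard_le_ncard (fun l hl => ?_) (Set.toFinite _)
              have := (hπ _ _).1 hl
              simp only [Set.mem_union, Set.mem_ofPred_eq]
              grind
            · rw [Set.disjoint_left]
              intro l h1 h2
              exact ht (h1.symm.trans h2)
          · refine le_trans (Set.ncard_le_ncard (fun l hl => ?_) (Set.toFinite _)) (hf y.1)
            have := (hπ _ _).1 hl
            simp only [Set.mem_ofPred_eq]
            grind)
      exact ⟨π ⁻¹' s, hs⟩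
    · push Not at hex
      -- every non-loop edge now joins a node with two tokens to a node with at least one
      have hcut : ∀ x, ∃ t, ¬ (p t ∈ ({x} : Set N) ↔ q t ∈ ({x} : Set N)) := by
        intro x
        refine hconn {x} (Set.singleton_nonempty x) ?_
        by_contra hne
        rw [Set.not_nonempty_iff_eq_empty, Set.compl_empty_iff] at hne
        have hx : (Finset.univ : Finset N) = {x} := by
          ext y
          have : y ∈ ({x} : Set N) := hne ▸ Set.mem_univ y
          simpa using this
        rw [hx, Finset.sum_singleton] at htot
        have := hf x
        lia
      have hone : ∀ x : N, 1 ≤ ({l | f l = x} : Set L).ncard := by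
        intro x
        obtain ⟨t, ht⟩ := hcut x
        have hpq : p t ≠ q t := fun h => ht (by rw [h])
        have h1 := hex t hpq
        have h2 := hf (p t)
        have h3 := hf (q t)
        simp only [Set.mem_singleton_iff] at ht
        by_cases hx : p t = x
        · rw [hx] at h1; lia
        · have hx' : q t = x := by tauto
          rw [hx'] at h1; lia
      obtain ⟨u, hu⟩ : ∃ u : N, ({l | f l = u} : Set L).ncard = 2 := by
        obtain ⟨x⟩ : Nonempty N := Fintype.card_pos_iff.1 (by lia)
        obtain ⟨t, ht⟩ := hcut x
        have h1 := hex t fun h => ht (by rw [h])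
        have h2 := hf (p t)
        have h3 := hf (q t)
        by_cases h : ({l | f l = p t} : Set L).ncard = 2
        · exact ⟨_, h⟩
        · exact ⟨q t, by lia⟩
      by_cases hδ : ({t | ¬ (p t ∈ ({u} : Set N) ↔ q t ∈ ({u} : Set N))} : Set T).ncard ≤ 2
      · exact ⟨{u}, Or.inl ⟨hδ, hu⟩⟩
      rw [not_le] at hδ
      have hsub : ({t | ¬ (p t ∈ ({u} : Set N) ↔ q t ∈ ({u} : Set N))} : Set T) ⊆
          {t | p t ≠ q t} := fun t ht h => ht (by rw [h])
      have hle := Set.ncard_le_ncard hsub (hfin _)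
      have hrest : ∑ x ∈ Finset.univ.erase u, ({l | f l = x} : Set L).ncard = 2 := by
        have := Finset.add_sum_erase Finset.univ (fun x => ({l | f l = x} : Set L).ncard)
          (Finset.mem_univ u)
        lia
      have hc2 : (Finset.univ.erase u : Finset N).card = n := by
        rw [Finset.card_erase_of_mem (Finset.mem_univ u), Finset.card_univ, hN]; rfl
      have hge : (Finset.univ.erase u : Finset N).card ≤ 2 := by
        rw [← hrest, Finset.card_eq_sum_ones]
        exact Finset.sum_le_sum fun x _ => hone x
      have hn : n = 2 := by lia
      obtain ⟨v, w, hvw, hE⟩ := Finset.card_eq_two.1 (hc2.trans hn)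
      rw [hE, Finset.sum_pair hvw] at hrest
      have hv1 := hone v
      have hw1 := hone w
      have hvu : v ≠ u := (Finset.mem_erase.1 (hE ▸ Finset.mem_insert_self v {w})).1
      have hwu : w ≠ u := (Finset.mem_erase.1
        (hE ▸ Finset.mem_insert_of_mem (Finset.mem_singleton_self w))).1
      have heq := Set.eq_of_subset_of_ncard_le hsub (by lia) (hfin _)
      have hpos : ∀ x,
          1 ≤ ({t | ¬ (p t ∈ ({x} : Set N) ↔ q t ∈ ({x} : Set N))} : Set T).ncard := fun x =>
        Nat.succ_le_of_lt ((Set.ncard_pos (hfin _)).2 (hcut x))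
      have hadd : ({t | ¬ (p t ∈ ({v} : Set N) ↔ q t ∈ ({v} : Set N))} : Set T).ncard +
          ({t | ¬ (p t ∈ ({w} : Set N) ↔ q t ∈ ({w} : Set N))} : Set T).ncard ≤ 3 := by
        rw [← Set.ncard_union_eq ?_ (hfin _) (hfin _)]
        · refine le_trans (Set.ncard_le_ncard ?_ (hfin _)) (hcard.trans (by lia))
          rintro t (ht | ht) h <;> exact ht (by rw [h])
        · rw [Set.disjoint_left]
          intro t h1 h2
          have h3 : t ∈ ({t | p t ≠ q t} : Set T) := fun h => h1 (by rw [h])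
          rw [← heq] at h3
          simp only [Set.mem_ofPred_eq, Set.mem_singleton_iff] at h1 h2 h3
          grind
      have hpv := hpos v
      have hpw := hpos w
      by_cases h : ({t | ¬ (p t ∈ ({v} : Set N) ↔ q t ∈ ({v} : Set N))} : Set T).ncard = 1
      · exact ⟨{v}, Or.inr ⟨h, by simp only [Set.mem_singleton_iff]; lia⟩⟩
      · exact ⟨{w}, Or.inr ⟨by lia, by simp only [Set.mem_singleton_iff]; lia⟩⟩

namespace Multigraph

variable (G : Multigraph)

/-- The rational incidence number of the edge `e` and the vertex `v`. -/
def incNum (e : G.E) (v : G.V) : ℚ :=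
  (if G.src e = v then 1 else 0) - (if G.tgt e = v then 1 else 0)

/-- `Ψ^{I,J}` vanishes iff at every rational point the deleted matrix has a nonzero kernel vector,
written as a current `y` on the edges and a potential `z` on the vertices. -/
theorem dodgson_eq_zero_iff (v0 : G.V) {I J : Set G.E} (hIJ : I.ncard = J.ncard) :
    G.dodgson v0 I J ∅ = 0 ↔ ∀ x : G.E → ℚ, ∃ (y : G.E → ℚ) (z : G.V → ℚ),
      (y ≠ 0 ∨ z ≠ 0) ∧ (∀ e ∈ J, y e = 0) ∧ z v0 = 0 ∧
      (∀ e ∉ I, x e * y e + (z (G.src e) - z (G.tgt e)) = 0) ∧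
      ∀ v ≠ v0, ∑ e, y e * G.incNum e v = 0 := by
  have hσ : Nonempty ({e : G.E // e ∉ I} ≃ {e : G.E // e ∉ J}) := by
    refine Finite.card_eq.1 ?_
    have hI := Set.ncard_add_ncard_compl I
    have hJ := Set.ncard_add_ncard_compl J
    have : Iᶜ.ncard = Jᶜ.ncard := by lia
    exact this
  rw [dodgson, dif_pos hσ]
  generalize hσ.some = σ
  simp only [Set.mem_empty_iff_false, if_false]
  rw [show (MvPolynomial.aeval fun e : G.E => (MvPolynomial.X e : MvPolynomial G.E ℤ)) =
    AlgHom.id ℤ _ from MvPolynomial.aeval_X_left, AlgHom.id_apply]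
  set M := (Matrix.of fun (r c : {e : G.E // e ∉ I} ⊕ {v : G.V // v ≠ v0}) =>
    G.bigMatrix v0 (Sum.map Subtype.val id r) (Sum.map (fun x => (σ x).1) id c)) with hM
  have hpoly : M.det = 0 ↔ ∀ x : G.E → ℚ,
      (M.map (MvPolynomial.aeval x : MvPolynomial G.E ℤ →ₐ[ℤ] ℚ)).det = 0 := by
    constructor
    · intro h x
      have := (AlgHom.map_det (MvPolynomial.aeval x : MvPolynomial G.E ℤ →ₐ[ℤ] ℚ) M).symm
      rw [h, map_zero] at this
      exact this
    · intro h
      apply MvPolynomial.map_injective (Int.castRingHom ℚ) Int.cast_injective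
      apply MvPolynomial.funext
      intro x
      have h1 := (AlgHom.map_det (MvPolynomial.aeval x : MvPolynomial G.E ℤ →ₐ[ℤ] ℚ) M)
      have h2 := h x
      rw [MvPolynomial.eval_map, map_zero, map_zero]
      rw [MvPolynomial.aeval_def] at h1
      exact h1.trans h2
  rw [hpoly]
  refine forall_congr' fun x => ?_
  have key : ∀ (y : G.E → ℚ) (z : G.V → ℚ), (∀ e ∈ J, y e = 0) → z v0 = 0 →
      (M.map (MvPolynomial.aeval x : MvPolynomial G.E ℤ →ₐ[ℤ] ℚ)).mulVec
        (Sum.elim (fun a => y (σ a).1) (fun w => z w.1)) =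
      Sum.elim (fun e => x e.1 * y e.1 + (z (G.src e.1) - z (G.tgt e.1)))
        (fun w => - ∑ e, y e * G.incNum e w.1) := by
    intro y z hy hz
    have hsum : ∀ g : G.E → ℚ, (∀ e ∈ J, g e = 0) →
        ∑ a : {e : G.E // e ∉ I}, g (σ a).1 = ∑ e, g e := by
      intro g hg
      rw [Equiv.sum_comp σ (fun e => g e.1)]
      rw [← Fintype.sum_subtype_add_sum_subtype (fun e => e ∉ J) g]
      rw [left_eq_add]
      exact Finset.sum_eq_zero fun e _ => hg e.1 (not_not.1 e.2)
    have hsumV : ∀ u : G.V, ∑ w : {v : G.V // v ≠ v0}, (if u = w.1 then 1 else 0) * z w.1 = z u := by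
      intro u
      have h1 := Fintype.sum_subtype_add_sum_subtype (fun v => v ≠ v0)
        (fun w => (if u = w then (1 : ℚ) else 0) * z w)
      rw [Finset.sum_eq_zero (s := (Finset.univ : Finset {v : G.V // ¬ v ≠ v0}))
        (fun w _ => by rw [not_not.1 w.2, hz, mul_zero]), add_zero] at h1
      rw [h1]
      simp
    have hinc : ∀ e v, MvPolynomial.aeval x (G.incCol e v) = G.incNum e v := by
      intro e v
      simp only [incCol, incNum, map_sub]
      split_ifs <;> simp
    ext r
    rcases r with e | w
    · simp only [Matrix.mulVec, dotProduct, Fintype.sum_sum_type, Matrix.map_apply, hM,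
        Matrix.of_apply, Sum.map_inl, Sum.map_inr, bigMatrix, Sum.elim_inl, Sum.elim_inr, id, hinc]
      congr 1
      · rw [hsum (fun f => (MvPolynomial.aeval x)
          (if e.1 = f then (MvPolynomial.X e.1 : MvPolynomial G.E ℤ) else 0) * y f)
          (fun f hf => by rw [hy f hf, mul_zero])]
        rw [Finset.sum_eq_single e.1]
        · simp
        · intro f _ hf
          simp [hf.symm]
        · simp
      · simp only [incNum, sub_mul, Finset.sum_sub_distrib, hsumV]
    · simp only [Matrix.mulVec, dotProduct, Fintype.sum_sum_type, Matrix.map_apply, hM,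
        Matrix.of_apply, Sum.map_inl, Sum.map_inr, bigMatrix, Sum.elim_inl, Sum.elim_inr, id, hinc,
        map_neg, map_zero, zero_mul, Finset.sum_const_zero, add_zero, neg_mul,
        Finset.sum_neg_distrib]
      rw [hsum (fun f => G.incNum f w.1 * y f) (fun f hf => by rw [hy f hf, mul_zero])]
      simp only [mul_comm]
  rw [← Matrix.exists_mulVec_eq_zero_iff]
  constructor
  · rintro ⟨v, hv, hv0⟩
    let y : G.E → ℚ := fun e => if h : e ∉ J then v (Sum.inl (σ.symm ⟨e, h⟩)) else 0
    let z : G.V → ℚ := fun w => if h : w ≠ v0 then v (Sum.inr ⟨w, h⟩) else 0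
    have hyJ : ∀ e ∈ J, y e = 0 := fun e he => dif_neg (not_not.2 he)
    have hz0 : z v0 = 0 := dif_neg (by simp)
    have hveq : Sum.elim (fun a => y (σ a).1) (fun w => z w.1) = v := by
      ext r
      rcases r with a | w
      · simp [y, (σ a).2]
      · simp [z, w.2]
    have hk := key y z hyJ hz0
    rw [hveq, hv0] at hk
    refine ⟨y, z, ?_, hyJ, hz0, fun e he => (congrFun hk (Sum.inl ⟨e, he⟩)).symm, fun w hw => ?_⟩
    · by_contra! hcon
      apply hv
      rw [← hveq, hcon.1, hcon.2]
      ext r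
      rcases r with a | w <;> rfl
    · have := (congrFun hk (Sum.inr ⟨w, hw⟩)).symm
      simpa using this
  · rintro ⟨y, z, hne, hyJ, hz0, h1, h2⟩
    refine ⟨Sum.elim (fun a => y (σ a).1) (fun w => z w.1), fun h0 => ?_, ?_⟩
    · have hy : y = 0 := by
        ext e
        by_cases he : e ∈ J
        · exact hyJ e he
        · have := congrFun h0 (Sum.inl (σ.symm ⟨e, he⟩))
          simpa using this
      have hz : z = 0 := by
        ext w
        by_cases hw : w = v0
        · rw [hw]; exact hz0
        · exact congrFun h0 (Sum.inr ⟨w, hw⟩)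
      exact hne.elim (fun h => h hy) (fun h => h hz)
    · rw [key y z hyJ hz0]
      ext r
      rcases r with e | w
      · exact h1 e.1 e.2
      · simp [h2 w.1 w.2]

theorem sum_incNum (e : G.E) : ∑ v, G.incNum e v = 0 := by
  simp [incNum, Finset.sum_sub_distrib]

/-- A separation with at least as many edges of `I` on the first side as there are shared
vertices, and no edge of `J` there, forces `Ψ^{I,J}` to vanish. -/
theorem dodgson_eq_zero_of_separation (v0 : G.V) {I J : Set G.E} (hIJ : I.ncard = J.ncard)
    {U1 U2 : Set G.V} {F1 F2 : Set G.E} (h1 : G.IsSubgraphPair U1 F1)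
    (h2 : G.IsSubgraphPair U2 F2) (hF : F1 ∪ F2 = Set.univ) (hU1 : U1.Nonempty)
    (hU2 : U2.Nonempty) (hJ : Disjoint F1 J) (hk : (U1 ∩ U2).ncard ≤ (F1 ∩ I).ncard) :
    G.dodgson v0 I J ∅ = 0 := by
  rw [G.dodgson_eq_zero_iff v0 hIJ]
  intro x
  obtain ⟨u, hu⟩ := hU1
  obtain ⟨p, hp⟩ := hU2
  have h2' : ∀ e ∉ F1, G.src e ∈ U2 ∧ G.tgt e ∈ U2 := fun e he =>
    h2 e ((hF ▸ Set.mem_univ e : e ∈ F1 ∪ F2).resolve_left he)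
  let Φ : ((G.E → ℚ) × (G.V → ℚ)) →ₗ[ℚ]
      ((F1ᶜ : Set G.E) ⊕ ((U1 \ U2)ᶜ : Set G.V) ⊕ (F1 \ I : Set G.E) ⊕ (U1 \ {u} : Set G.V) → ℚ) :=
    { toFun := fun yz => Sum.elim (fun e => yz.1 e.1) (Sum.elim (fun v => yz.2 v.1)
        (Sum.elim (fun e => x e.1 * yz.1 e.1 + (yz.2 (G.src e.1) - yz.2 (G.tgt e.1)))
          (fun v => ∑ e, yz.1 e * G.incNum e v.1)))
      map_add' := by
        intro a b
        ext (r | r | r | r)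
        · simp
        · simp
        · simp; ring
        · simp [add_mul, Finset.sum_add_distrib]
      map_smul' := by
        intro c a
        ext (r | r | r | r)
        · simp
        · simp
        · simp; ring
        · simp [mul_assoc, Finset.mul_sum] }
  have hlt : Module.finrank ℚ ((F1ᶜ : Set G.E) ⊕ ((U1 \ U2)ᶜ : Set G.V) ⊕ (F1 \ I : Set G.E) ⊕
      (U1 \ {u} : Set G.V) → ℚ) < Module.finrank ℚ ((G.E → ℚ) × (G.V → ℚ)) := by
    rw [Module.finrank_prod]
    simp only [Module.finrank_fintype_fun_eq_card, Fintype.card_sum]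
    simp only [Fintype.card_eq_nat_card, Nat.card_coe_set_eq]
    have c1 := Set.ncard_add_ncard_compl F1
    have c2 := Set.ncard_add_ncard_compl (U1 \ U2)
    have c3 := Set.ncard_inter_add_ncard_sdiff_eq_ncard F1 I
    have c4 := Set.ncard_inter_add_ncard_sdiff_eq_ncard U1 U2
    have c5 := Set.ncard_sdiff_singleton_add_one hu
    lia
  obtain ⟨⟨y, z⟩, hker, hne⟩ := (Submodule.ne_bot_iff _).1 (LinearMap.ker_ne_bot_of_finrank_lt
    (f := Φ) hlt)
  have hΦ : Φ (y, z) = 0 := hker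
  have hy : ∀ e ∉ F1, y e = 0 := fun e he => congrFun hΦ (Sum.inl ⟨e, he⟩)
  have hz : ∀ v ∈ U2, z v = 0 := fun v hv =>
    congrFun hΦ (Sum.inr (Sum.inl ⟨v, fun h => h.2 hv⟩))
  have hedge : ∀ e ∈ F1, e ∉ I → x e * y e + (z (G.src e) - z (G.tgt e)) = 0 := fun e he heI =>
    congrFun hΦ (Sum.inr (Sum.inr (Sum.inl ⟨e, he, heI⟩)))
  have hvert : ∀ v ∈ U1, v ≠ u → ∑ e, y e * G.incNum e v = 0 := fun v hv hvu =>
    congrFun hΦ (Sum.inr (Sum.inr (Sum.inr ⟨v, hv, hvu⟩)))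
  have hcons : ∀ v ≠ u, ∑ e, y e * G.incNum e v = 0 := by
    intro v hvu
    by_cases hv : v ∈ U1
    · exact hvert v hv hvu
    · refine Finset.sum_eq_zero fun e _ => ?_
      by_cases he : e ∈ F1
      · have hs : G.src e ≠ v := fun h => hv (h ▸ (h1 e he).1)
        have ht : G.tgt e ≠ v := fun h => hv (h ▸ (h1 e he).2)
        simp [incNum, hs, ht]
      · rw [hy e he, zero_mul]
  refine ⟨y, fun v => z v - z v0, ?_, fun e he => hy e (Set.disjoint_right.1 hJ he), sub_self _,
    fun e he => ?_, fun v _ => ?_⟩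
  · by_contra! hcon
    apply hne
    have hp0 := congrFun hcon.2 p
    simp only [hz p hp, Pi.zero_apply, zero_sub, neg_eq_zero] at hp0
    refine Prod.ext hcon.1 (funext fun v => ?_)
    have := congrFun hcon.2 v
    simpa [hp0] using this
  · rw [sub_sub_sub_cancel_right]
    by_cases heF : e ∈ F1
    · exact hedge e heF he
    · rw [hy e heF, hz _ (h2' e heF).1, hz _ (h2' e heF).2]; simp
  · by_cases hvu : v = u
    · have htot : ∑ v, ∑ e, y e * G.incNum e v = 0 := by
        rw [Finset.sum_comm]
        exact Finset.sum_eq_zero fun e _ => by rw [← Finset.mul_sum, G.sum_incNum, mul_zero]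
      rw [Finset.sum_eq_single v (fun w _ hw => hcons w (hvu ▸ hw)) (by simp)] at htot
      exact htot
    · exact hcons v hvu

/-- The image of the vertex `v` in the space of vectors indexed by the vertices other than `v0`;
the vertex `v0` itself becomes zero. -/
def vertexVec (v0 v : G.V) : {v : G.V // v ≠ v0} → ℚ := fun w => if v = w.1 then 1 else 0

/-- The row of the reduced incidence matrix indexed by the edge `e`. -/
def edgeVec (v0 : G.V) (e : G.E) : {v : G.V // v ≠ v0} → ℚ :=
  G.vertexVec v0 (G.src e) - G.vertexVec v0 (G.tgt e)

/-- The rank of an edge set, as the rank of its rows in the reduced incidence matrix. -/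
def rankOn (v0 : G.V) (A : Finset G.E) : ℕ :=
  Module.finrank ℚ (Submodule.span ℚ (G.edgeVec v0 '' A))

theorem isRankFunction_rankOn (v0 : G.V) : IsRankFunction (G.rankOn v0) := by
  have hmono : ∀ A B : Finset G.E, A ⊆ B → G.rankOn v0 A ≤ G.rankOn v0 B := fun A B h =>
    Submodule.finrank_mono (Submodule.span_mono (Set.image_mono (Finset.coe_subset.2 h)))
  have hsub : ∀ A B : Finset G.E,
      G.rankOn v0 (A ∪ B) + G.rankOn v0 (A ∩ B) ≤ G.rankOn v0 A + G.rankOn v0 B := by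
    intro A B
    unfold rankOn
    rw [← Submodule.finrank_sup_add_finrank_inf_eq (Submodule.span ℚ (G.edgeVec v0 '' A))
      (Submodule.span ℚ (G.edgeVec v0 '' B)), Finset.coe_union, Set.image_union,
      Submodule.span_union]
    refine Nat.add_le_add_left (Submodule.finrank_mono (le_inf ?_ ?_)) _
    · exact Submodule.span_mono (Set.image_mono (Finset.coe_subset.2 Finset.inter_subset_left))
    · exact Submodule.span_mono (Set.image_mono (Finset.coe_subset.2 Finset.inter_subset_right))
  refine ⟨by simp [rankOn], fun e A => ?_, hmono, hsub⟩
  have h1 := hsub A {e}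
  have h2 : G.rankOn v0 {e} ≤ 1 := by
    have := finrank_span_le_card (R := ℚ) ({G.edgeVec v0 e} : Set _)
    rw [rankOn, Finset.coe_singleton, Set.image_singleton]
    simpa using this
  rw [Finset.insert_eq, Finset.union_comm]
  lia

theorem finrank_reduced (v0 : G.V) :
    Module.finrank ℚ ({v : G.V // v ≠ v0} → ℚ) + 1 = Fintype.card G.V := by
  have : 0 < Fintype.card G.V := Fintype.card_pos_iff.2 ⟨v0⟩
  rw [Module.finrank_fintype_fun_eq_card, Fintype.card_subtype_compl, Fintype.card_subtype_eq]
  lia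

theorem rankOn_lt (v0 : G.V) (A : Finset G.E) : G.rankOn v0 A < Fintype.card G.V := by
  have h := Submodule.finrank_le (Submodule.span ℚ (G.edgeVec v0 '' A))
  have := G.finrank_reduced v0
  unfold rankOn
  lia

theorem span_edgeVec_eq_top {v0 : G.V} {A : Finset G.E}
    (h : G.rankOn v0 A + 1 = Fintype.card G.V) :
    Submodule.span ℚ (G.edgeVec v0 '' A) = ⊤ := by
  apply Submodule.eq_top_of_finrank_eq
  have := G.finrank_reduced v0
  unfold rankOn at h
  lia

theorem linearIndepOn_edgeVec {v0 : G.V} {A : Finset G.E} (h : G.rankOn v0 A = A.card) :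
    LinearIndepOn ℚ (G.edgeVec v0) (A : Set G.E) := by
  rw [LinearIndepOn, linearIndependent_iff_card_eq_finrank_span, Set.finrank]
  rw [← Set.image_eq_range]
  simpa [rankOn] using h.symm

/-- A set completed to a spanning tree by `I` and by `J` contributes a monomial to `Ψ^{I,J}`. -/
theorem dodgson_ne_zero (v0 : G.V) {I J U : Finset G.E} (hIJ : I.card = J.card)
    (hdIJ : Disjoint I J) (hUI : Disjoint U I)
    (hI : G.rankOn v0 (U ∪ I) = (U ∪ I).card)
    (hJ : G.rankOn v0 (U ∪ J) + 1 = Fintype.card G.V) :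
    G.dodgson v0 I J ∅ ≠ 0 := by
  rw [Ne, G.dodgson_eq_zero_iff v0 (by simpa using hIJ)]
  intro hall
  obtain ⟨y, z, hne, hyJ, hz0, hedge, hvert⟩ :=
    hall fun e => if e ∈ U ∪ I ∪ J then 0 else 1
  have hsingle : ∀ v : G.V, ∑ w : {v : G.V // v ≠ v0}, G.vertexVec v0 v w * z w.1 = z v := by
    intro v
    by_cases hv : v = v0
    · rw [hv, hz0]
      refine Finset.sum_eq_zero fun w _ => ?_
      simp [vertexVec, w.2.symm]
    · rw [Finset.sum_eq_single ⟨v, hv⟩]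
      · simp [vertexVec]
      · intro w _ hw
        have : v ≠ w.1 := fun h => hw (Subtype.ext h.symm)
        simp [vertexVec, this]
      · simp
  let pairing : ({v : G.V // v ≠ v0} → ℚ) →ₗ[ℚ] ℚ :=
    ∑ w : {v : G.V // v ≠ v0}, z w.1 • LinearMap.proj w
  have hpair : ∀ v, pairing (G.vertexVec v0 v) = z v := by
    intro v
    rw [← hsingle v]
    simp [pairing, mul_comm]
  have hpair0 : pairing = 0 := by
    apply LinearMap.ext_on_range (v := fun e : (↑(U ∪ J) : Set G.E) => G.edgeVec v0 e)
    · rw [← G.span_edgeVec_eq_top hJ]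
      rw [Set.image_eq_range]
    · rintro ⟨e, he⟩
      have heUJ : e ∈ U ∪ J := he
      have heI : e ∉ (I : Set G.E) := by
        intro heI
        rcases Finset.mem_union.1 heUJ with h | h
        · exact Finset.disjoint_left.1 hUI h heI
        · exact Finset.disjoint_left.1 hdIJ heI h
      have := hedge e heI
      rw [if_pos (by simp only [Finset.mem_union] at heUJ ⊢; tauto), zero_mul, zero_add] at this
      simp only [edgeVec, map_sub, hpair, this, LinearMap.zero_apply, sub_zero]
  have hz : z = 0 := by
    ext v
    rw [← hpair v, hpair0]; rfl
  have hysupp : ∀ e ∉ U ∪ I, y e = 0 := by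
    intro e he
    by_cases heJ : e ∈ J
    · exact hyJ e heJ
    · have heI : e ∉ (I : Set G.E) := fun h => he (Finset.mem_union_right _ h)
      have := hedge e heI
      rw [if_neg (by simp only [Finset.mem_union] at he ⊢; tauto), hz] at this
      simpa using this
  have hcomb : ∑ e ∈ U ∪ I, y e • G.edgeVec v0 e = 0 := by
    rw [Finset.sum_subset (Finset.subset_univ _) (fun e _ he => by rw [hysupp e he, zero_smul])]
    ext w
    have := hvert w.1 w.2
    simpa [edgeVec, vertexVec, incNum] using this
  have hy : y = 0 := by
    ext e
    by_cases he : e ∈ U ∪ I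
    · exact linearIndepOn_finset_iff.1 (G.linearIndepOn_edgeVec hI) y hcomb e he
    · exact hysupp e he
  exact hne.elim (fun h => h hy) (fun h => h hz)

/-- The connected components of the spanning subgraph with edge set `A`. -/
abbrev Comp (A : Set G.E) : Type :=
  Quot fun a b : G.V => ∃ e ∈ A, G.src e = a ∧ G.tgt e = b

instance (A : Set G.E) : Finite (G.Comp A) :=
  Finite.of_surjective (Quot.mk _) fun q => Quot.exists_rep q

/-- The component containing both ends of an edge of `A`. -/
theorem comp_src_eq_comp_tgt {A : Set G.E} {e : G.E} (he : e ∈ A) :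
    (Quot.mk _ (G.src e) : G.Comp A) = Quot.mk _ (G.tgt e) :=
  Quot.sound ⟨e, he, rfl, rfl⟩

theorem card_le_rankOn_add_card_comp (v0 : G.V) (A : Finset G.E) :
    Fintype.card G.V ≤ G.rankOn v0 A + Nat.card (G.Comp (A : Set G.E)) := by
  have := Fintype.ofFinite (G.Comp (A : Set G.E))
  set W := Submodule.span ℚ (G.edgeVec v0 '' A) with hW
  let g : G.Comp (A : Set G.E) → ({v : G.V // v ≠ v0} → ℚ) ⧸ W :=
    Quot.lift (fun v => W.mkQ (G.vertexVec v0 v)) (by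
      rintro _ _ ⟨e, he, rfl, rfl⟩
      rw [← sub_eq_zero, ← map_sub]
      exact (Submodule.Quotient.mk_eq_zero W).2 (Submodule.subset_span ⟨e, he, rfl⟩))
  have hg0 : g (Quot.mk _ v0) = 0 := by
    have : G.vertexVec v0 v0 = 0 := by
      ext w
      simp [vertexVec, w.2.symm]
    simp only [g, this, map_zero]
  let g' : {c : G.Comp (A : Set G.E) // c ≠ Quot.mk _ v0} → ({v : G.V // v ≠ v0} → ℚ) ⧸ W :=
    fun c => g c.1
  have hmem : ∀ v, W.mkQ (G.vertexVec v0 v) ∈ Submodule.span ℚ (Set.range g') := by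
    intro v
    by_cases hc : (Quot.mk _ v : G.Comp (A : Set G.E)) = Quot.mk _ v0
    · have : W.mkQ (G.vertexVec v0 v) = 0 := by
        rw [← hg0, ← hc]
      rw [this]
      exact Submodule.zero_mem _
    · exact Submodule.subset_span ⟨⟨_, hc⟩, rfl⟩
  have htop : Submodule.span ℚ (Set.range g') = ⊤ := by
    rw [eq_top_iff]
    rintro q -
    obtain ⟨f, rfl⟩ := W.mkQ_surjective q
    have hf : f = ∑ w : {v : G.V // v ≠ v0}, f w • G.vertexVec v0 w.1 := by
      ext w
      rw [Finset.sum_apply, Finset.sum_eq_single w]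
      · simp [vertexVec]
      · intro w' _ hw
        have : w'.1 ≠ w.1 := fun h => hw (Subtype.ext h)
        simp [vertexVec, this]
      · simp
    rw [hf, map_sum]
    refine Submodule.sum_mem _ fun w _ => ?_
    rw [map_smul]
    exact Submodule.smul_mem _ _ (hmem _)
  have h1 := finrank_range_le_card (R := ℚ) g'
  rw [Set.finrank, htop, finrank_top, Fintype.card_subtype_compl, Fintype.card_subtype_eq] at h1
  have h2 := W.finrank_quotient_add_finrank
  have h3 := G.finrank_reduced v0
  have h4 : 0 < Fintype.card (G.Comp (A : Set G.E)) := Fintype.card_pos_iff.2 ⟨Quot.mk _ v0⟩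
  rw [Nat.card_eq_fintype_card, rankOn, ← hW]
  lia

theorem rankOn_le_card (v0 : G.V) (A : Finset G.E) : G.rankOn v0 A ≤ A.card := by
  have hr := G.isRankFunction_rankOn v0
  induction A using Finset.induction_on with
  | empty => simp [hr.empty]
  | insert e A he ih =>
    have := hr.insert_le e A
    rw [Finset.card_insert_of_notMem he]
    lia

/-- If `Ψ^{I,J}` vanishes, the common independent sets of the contractions by `I` and by `J` are
small, so some edge set containing `I` and avoiding `J` (or one of `I`, `J`) has low
connectivity. -/
theorem exists_rankOn_add_rankOn_compl_le (v0 : G.V) {I J : Finset G.E} (hIJ : Disjoint I J)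
    (hI : I.card = 2) (hJ : J.card = 2) (h : G.dodgson v0 I J ∅ = 0) :
    ∃ A : Finset G.E, (I ⊆ A ∧ Disjoint A J ∨ J ⊆ A ∧ Disjoint A I) ∧
      G.rankOn v0 A + G.rankOn v0 Aᶜ ≤ Fintype.card G.V := by
  have hr := G.isRankFunction_rankOn v0
  have hI2 := G.rankOn_le_card v0 I
  have hJ2 := G.rankOn_le_card v0 J
  by_cases hI1 : G.rankOn v0 I ≤ 1
  · have := G.rankOn_lt v0 Iᶜ
    exact ⟨I, Or.inl ⟨subset_rfl, hIJ⟩, by lia⟩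
  by_cases hJ1 : G.rankOn v0 J ≤ 1
  · have := G.rankOn_lt v0 Jᶜ
    exact ⟨J, Or.inr ⟨subset_rfl, hIJ.symm⟩, by lia⟩
  obtain ⟨U, hU, A, hA, hU1, hU2, hle⟩ :=
    IsRankFunction.exists_common_indep (I ∪ J)ᶜ (hr.contract I) (hr.contract J)
  have hUI : Disjoint U I := by
    refine Finset.disjoint_left.2 fun e he heI => ?_
    have := hU he
    simp [heI] at this
  have hAJ : Disjoint A J := by
    refine Finset.disjoint_left.2 fun e he heJ => ?_
    have := hA he
    simp [heJ] at this
  have m1 := hr.mono I (U ∪ I) Finset.subset_union_right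
  have m2 := hr.mono J (U ∪ J) Finset.subset_union_right
  have hcard := Finset.card_union_of_disjoint hUI
  have hlt := G.rankOn_lt v0 (U ∪ J)
  have hne : ¬ G.rankOn v0 (U ∪ J) + 1 = Fintype.card G.V := fun heq =>
    G.dodgson_ne_zero v0 (hI.trans hJ.symm) hIJ hUI (by lia) heq h
  have hcompl : (A ∪ I)ᶜ = ((I ∪ J)ᶜ \ A) ∪ J := by
    ext e
    have h1 : e ∈ I → e ∉ J := fun h => Finset.disjoint_left.1 hIJ h
    have h2 : e ∈ A → e ∉ J := fun h => Finset.disjoint_left.1 hAJ h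
    simp only [Finset.mem_compl, Finset.mem_union, Finset.mem_sdiff]
    tauto
  refine ⟨A ∪ I, Or.inl ⟨Finset.subset_union_right, Finset.disjoint_union_left.2 ⟨hAJ, hIJ⟩⟩, ?_⟩
  rw [hcompl]
  lia

/-- The component of `A`, or of its complement, on which the edge `e` lies. -/
def edgeComp (A : Set G.E) (e : G.E) : G.Comp A ⊕ G.Comp Aᶜ :=
  if e ∈ A then Sum.inl (Quot.mk _ (G.src e)) else Sum.inr (Quot.mk _ (G.src e))

/-- The bipartite graph of components of `A` and `Aᶜ`, with the vertices of `G` as its edges, is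
connected when `G` is. -/
theorem exists_crossing_vertex (hG : G.Connected) (A : Set G.E) (s : Set (G.Comp A ⊕ G.Comp Aᶜ))
    (hs : s.Nonempty) (hs' : sᶜ.Nonempty) :
    ∃ v : G.V, ¬ ((Sum.inl (Quot.mk _ v) : G.Comp A ⊕ G.Comp Aᶜ) ∈ s ↔
      (Sum.inr (Quot.mk _ v) : G.Comp A ⊕ G.Comp Aᶜ) ∈ s) := by
  by_contra! hcon
  have hedge : ∀ e : G.E, (Sum.inl (Quot.mk _ (G.src e)) : G.Comp A ⊕ G.Comp Aᶜ) ∈ s ↔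
      (Sum.inl (Quot.mk _ (G.tgt e)) : G.Comp A ⊕ G.Comp Aᶜ) ∈ s := by
    intro e
    by_cases he : e ∈ A
    · rw [G.comp_src_eq_comp_tgt he]
    · rw [hcon, hcon, G.comp_src_eq_comp_tgt (A := Aᶜ) he]
  have hall : ∀ a b : G.V, (Sum.inl (Quot.mk _ a) : G.Comp A ⊕ G.Comp Aᶜ) ∈ s →
      (Sum.inl (Quot.mk _ b) : G.Comp A ⊕ G.Comp Aᶜ) ∈ s := by
    intro a b ha
    induction hG.2 a (Set.mem_univ _) b (Set.mem_univ _) with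
    | refl => exact ha
    | tail _ hstep ih =>
      obtain ⟨-, -, e, -, ⟨rfl, rfl⟩ | ⟨rfl, rfl⟩⟩ := hstep
      · exact (hedge e).1 ih
      · exact (hedge e).2 ih
  have hrep : ∀ x : G.Comp A ⊕ G.Comp Aᶜ, ∃ v : G.V,
      (x ∈ s ↔ (Sum.inl (Quot.mk _ v) : G.Comp A ⊕ G.Comp Aᶜ) ∈ s) := by
    rintro (x | x) <;> obtain ⟨v, rfl⟩ := Quot.exists_rep x
    · exact ⟨v, Iff.rfl⟩
    · exact ⟨v, (hcon v).symm⟩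
  obtain ⟨x, hx⟩ := hs
  obtain ⟨y, hy⟩ := hs'
  obtain ⟨a, ha⟩ := hrep x
  obtain ⟨b, hb⟩ := hrep y
  exact hy (hb.2 (hall a b (ha.1 hx)))

theorem splitWitness_of_rankOn_add_rankOn_compl_le (hG : G.Connected) {S : Set G.E}
    (hS : S.ncard = 4) (v0 : G.V) {A : Finset G.E} (hAS : (↑A ∩ S).ncard = 2)
    (hrank : G.rankOn v0 A + G.rankOn v0 Aᶜ ≤ Fintype.card G.V) : G.splitWitness S := by
  have hAS' : ((↑A : Set G.E)ᶜ ∩ S).ncard = 2 := by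
    have := Set.ncard_inter_add_ncard_sdiff_eq_ncard S ↑A
    rw [Set.inter_comm] at hAS
    rw [← Set.sdiff_eq_compl_inter]
    lia
  have hfin : Fintype (G.Comp (A : Set G.E) ⊕ G.Comp (A : Set G.E)ᶜ) := Fintype.ofFinite _
  have hL : Fintype.card S = 4 := by rw [Fintype.card_eq_nat_card, Nat.card_coe_set_eq, hS]
  have hcard : Fintype.card G.V ≤
      Fintype.card (G.Comp (A : Set G.E) ⊕ G.Comp (A : Set G.E)ᶜ) := by
    have h1 := G.card_le_rankOn_add_card_comp v0 A
    have h2 := G.card_le_rankOn_add_card_comp v0 Aᶜ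
    rw [Finset.coe_compl] at h2
    rw [← Nat.card_eq_fintype_card (α := _ ⊕ _), Nat.card_sum]
    lia
  let node₁ : G.V → G.Comp (A : Set G.E) ⊕ G.Comp (A : Set G.E)ᶜ := fun v => Sum.inl (Quot.mk _ v)
  let node₂ : G.V → G.Comp (A : Set G.E) ⊕ G.Comp (A : Set G.E)ᶜ := fun v => Sum.inr (Quot.mk _ v)
  obtain ⟨s, hs⟩ := exists_small_balanced_cut hL _ (G.Comp (A : Set G.E) ⊕ G.Comp (A : Set G.E)ᶜ)
    node₁ node₂ (fun e : S => G.edgeComp A e.1) rfl (G.exists_crossing_vertex hG A)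
    ((Set.ncard_le_card _).trans (by rwa [Nat.card_eq_fintype_card])) (by
      intro x
      rw [← Set.ncard_image_of_injective _ Subtype.val_injective]
      rcases x with x | x
      · rw [← hAS]
        refine Set.ncard_le_ncard ?_
        rintro _ ⟨⟨e, he⟩, hex : G.edgeComp A e = _, rfl⟩
        refine ⟨by_contra fun heA => ?_, he⟩
        rw [edgeComp, if_neg heA] at hex
        exact Sum.inr_ne_inl hex
      · rw [← hAS']
        refine Set.ncard_le_ncard ?_
        rintro _ ⟨⟨e, he⟩, hex : G.edgeComp A e = _, rfl⟩
        refine ⟨fun heA => ?_, he⟩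
        rw [edgeComp, if_pos heA] at hex
        exact Sum.inl_ne_inr hex)
  have hends : ∀ e, (G.edgeComp A e = node₁ (G.src e) ∧ G.edgeComp A e = node₁ (G.tgt e)) ∨
      (G.edgeComp A e = node₂ (G.src e) ∧ G.edgeComp A e = node₂ (G.tgt e)) := by
    intro e
    by_cases he : e ∈ (A : Set G.E)
    · rw [edgeComp, if_pos he]
      exact Or.inl ⟨rfl, congrArg Sum.inl (G.comp_src_eq_comp_tgt he)⟩
    · rw [edgeComp, if_neg he]
      exact Or.inr ⟨rfl, congrArg Sum.inr (G.comp_src_eq_comp_tgt (A := (A : Set G.E)ᶜ) he)⟩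
  have hU : {v | node₁ v ∈ s ∨ node₂ v ∈ s} ∩ {v | node₁ v ∉ s ∨ node₂ v ∉ s} =
      {v | ¬ (node₁ v ∈ s ↔ node₂ v ∈ s)} := by
    ext v
    simp only [Set.mem_inter_iff, Set.mem_ofPred_eq]
    tauto
  have hF : {e | G.edgeComp A e ∈ s} ∩ S = Subtype.val '' {e : S | G.edgeComp A e.1 ∈ s} := by
    ext e
    simp [and_comm]
  refine ⟨{v | node₁ v ∈ s ∨ node₂ v ∈ s}, {v | node₁ v ∉ s ∨ node₂ v ∉ s},
    {e | G.edgeComp A e ∈ s}, {e | G.edgeComp A e ∉ s}, ?_, ?_, ?_, ?_, ?_, ?_⟩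
  · intro e he
    rcases hends e with ⟨h1, h2⟩ | ⟨h1, h2⟩
    · exact ⟨Or.inl (by rwa [← h1]), Or.inl (by rwa [← h2])⟩
    · exact ⟨Or.inr (by rwa [← h1]), Or.inr (by rwa [← h2])⟩
  · intro e he
    rcases hends e with ⟨h1, h2⟩ | ⟨h1, h2⟩
    · exact ⟨Or.inl (by rwa [← h1]), Or.inl (by rwa [← h2])⟩
    · exact ⟨Or.inr (by rwa [← h1]), Or.inr (by rwa [← h2])⟩
  · exact Set.disjoint_left.2 fun e he he' => he' he
  · ext v
    simp only [Set.mem_union, Set.mem_ofPred_eq, Set.mem_univ, iff_true]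
    tauto
  · ext e
    simp only [Set.mem_union, Set.mem_ofPred_eq, Set.mem_univ, iff_true]
    tauto
  · rw [hU, hF, Set.ncard_image_of_injective _ Subtype.val_injective]
    exact hs

theorem exists_dodgson_eq_zero_of_splitWitness {S : Set G.E} (hS : S.ncard = 4)
    (h : G.splitWitness S) :
    ∃ S1 S2 : Set G.E, S1 ∪ S2 = S ∧ Disjoint S1 S2 ∧
      S1.ncard = 2 ∧ S2.ncard = 2 ∧ ∀ v0 : G.V, G.dodgson v0 S1 S2 ∅ = 0 := by
  obtain ⟨U1, U2, F1, F2, h1, h2, -, -, hF, hcase⟩ := h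
  have hpos : 0 < (F1 ∩ S).ncard := by lia
  have hle : (F1 ∩ S).ncard ≤ 2 := by lia
  have hk : (U1 ∩ U2).ncard ≤ (F1 ∩ S).ncard := by lia
  obtain ⟨I, hFI, hIS, hI⟩ := Set.exists_subsuperset_card_eq
    (Set.inter_subset_right : F1 ∩ S ⊆ S) hle (by lia : 2 ≤ S.ncard)
  have hJ : (S \ I).ncard = 2 := by
    have := Set.ncard_sdiff_add_ncard_of_subset hIS
    lia
  obtain ⟨a, haF, -⟩ := Set.nonempty_of_ncard_ne_zero hpos.ne'
  obtain ⟨b, hbS, hbI⟩ := Set.nonempty_of_ncard_ne_zero (hJ ▸ two_ne_zero)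
  have hbF : b ∈ F2 := (hF ▸ Set.mem_univ b : b ∈ F1 ∪ F2).resolve_left
    fun hb => hbI (hFI ⟨hb, hbS⟩)
  have hFI' : F1 ∩ S ⊆ F1 ∩ I := fun e he => ⟨he.1, hFI he⟩
  exact ⟨I, S \ I, Set.union_sdiff_cancel hIS, Set.disjoint_sdiff_right, hI, hJ, fun v0 =>
    G.dodgson_eq_zero_of_separation v0 (hI.trans hJ.symm) h1 h2 hF ⟨_, (h1 a haF).1⟩
      ⟨_, (h2 b hbF).1⟩ (Set.disjoint_left.2 fun e he heJ => heJ.2 (hFI ⟨he, heJ.1⟩))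
      (hk.trans (Set.ncard_le_ncard hFI'))⟩

end Multigraph

theorem stmt12 (G : Multigraph) (hG : G.Connected) (S : Set G.E) (hS : S.ncard = 4) :
    (∃ S1 S2 : Set G.E, S1 ∪ S2 = S ∧ Disjoint S1 S2 ∧
        S1.ncard = 2 ∧ S2.ncard = 2 ∧ ∀ v0 : G.V, G.dodgson v0 S1 S2 ∅ = 0) ↔
      G.splitWitness S := by
  refine ⟨?_, G.exists_dodgson_eq_zero_of_splitWitness hS⟩
  rintro ⟨S1, S2, rfl, hdisj, hS1, hS2, hzero⟩
  obtain ⟨v0, -⟩ := hG.1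
  obtain ⟨I, rfl⟩ := S1.toFinite.exists_finset_coe
  obtain ⟨J, rfl⟩ := S2.toFinite.exists_finset_coe
  rw [Finset.disjoint_coe] at hdisj
  rw [Set.ncard_coe_finset] at hS1 hS2
  obtain ⟨A, hA, hrank⟩ := G.exists_rankOn_add_rankOn_compl_le v0 hdisj hS1 hS2 (hzero v0)
  refine G.splitWitness_of_rankOn_add_rankOn_compl_le hG hS v0 ?_ hrank
  rw [← Finset.coe_union, ← Finset.coe_inter, Set.ncard_coe_finset, Finset.inter_union_distrib_left]
  rcases hA with ⟨hIA, hAJ⟩ | ⟨hJA, hAI⟩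
  · rw [Finset.inter_eq_right.2 hIA, Finset.disjoint_iff_inter_eq_empty.1 hAJ, Finset.union_empty,
      hS1]
  · rw [Finset.inter_eq_right.2 hJA, Finset.disjoint_iff_inter_eq_empty.1 hAI, Finset.empty_union,
      hS2]
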